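/- (Benjamin–Ono soliton profile identity) Let λ > 0 and let u : ℝ → ℝ be given by u(x) = 4λ/(1 + λ²x²). Then for every x ∈ ℝ: (D u)(x) = 4λ²(1 − λ²x²)/(1 + λ²x²)², and consequently u satisfies the profile equation (D u)(x) + λ u(x) = u(x)²/2 for all x ∈ ℝ. -/

import Mathlib

open MeasureTheory

noncomputable section

/-- The Fourier transform with convention `û(ξ) = (2π)^{-1/2} ∫ u(x) e^{-ixξ} dx`. -/
def ft (u : ℝ → ℂ) (ξ : ℝ) : ℂ :=
  (Real.sqrt (2 * Real.pi) : ℂ)⁻¹ * ∫ x : ℝ, u x * Complex.exp (-(Complex.I * x * ξ))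

/-- The Fourier multiplier `D^s` with symbol `|ξ|^s`:
`(D^s u)(x) = (2π)^{-1/2} ∫ |ξ|^s û(ξ) e^{ixξ} dξ`. In particular `D = D^1` is the
operator `𝓗 ∂ₓ` appearing in the Benjamin–Ono equation. -/
def Dop (s : ℝ) (u : ℝ → ℂ) (x : ℝ) : ℂ :=
  (Real.sqrt (2 * Real.pi) : ℂ)⁻¹ *
    ∫ ξ : ℝ, ((|ξ| ^ s : ℝ) : ℂ) * ft u ξ * Complex.exp (Complex.I * x * ξ)

open Set Filter Topology FourierTransform

/-- An integral over the line is the sum of the integrals over the two half-lines. -/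
lemma integrable_and_integral_eq_Ioi_add {f : ℝ → ℂ} (hf : IntegrableOn f (Ioi 0))
    (hf' : IntegrableOn (fun x => f (-x)) (Ioi 0)) :
    Integrable f ∧ ∫ x, f x = (∫ x in Ioi 0, f x) + ∫ x in Ioi 0, f (-x) := by
  have h : IntegrableOn f (Iic 0) := by
    rw [integrableOn_Iic_iff_integrableOn_Iio]
    simpa using IntegrableOn.comp_neg_Iio (c := (0 : ℝ)) (f := fun x => f (-x)) (by simpa using hf')
  refine ⟨by rw [← integrableOn_univ, ← Iic_union_Ioi (a := (0 : ℝ))]; exact h.union hf, ?_⟩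
  rw [← intervalIntegral.integral_Iic_add_Ioi h hf, integral_comp_neg_Ioi, neg_zero, add_comm]

lemma integrableOn_mul_exp_mul_complex_Ioi {a : ℂ} (ha : a.re < 0) :
    IntegrableOn (fun x : ℝ => (x : ℂ) * Complex.exp (a * x)) (Ioi 0) := by
  have h := integrableOn_rpow_mul_exp_neg_mul_rpow (p := 1) (s := 1) (b := -a.re)
    (by norm_num) one_pos (by linarith)
  refine h.mono' (Continuous.aestronglyMeasurable (by fun_prop)) ?_
  filter_upwards [ae_restrict_mem measurableSet_Ioi] with x hx
  simp [Complex.norm_exp, abs_of_pos (mem_Ioi.mp hx)]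

lemma integral_mul_exp_mul_complex_Ioi {a : ℂ} (ha : a.re < 0) :
    ∫ x : ℝ in Ioi 0, (x : ℂ) * Complex.exp (a * x) = 1 / a ^ 2 := by
  have ha0 : a ≠ 0 := by rintro rfl; simp at ha
  have hderiv : ∀ x ∈ Ici (0 : ℝ), HasDerivAt
      (fun x : ℝ => ((x : ℂ) / a - 1 / a ^ 2) * Complex.exp (a * x))
      ((x : ℂ) * Complex.exp (a * x)) x := by
    intro x _
    have h1 : HasDerivAt (fun x : ℝ => (x : ℂ)) 1 x := Complex.ofRealCLM.hasDerivAt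
    refine (((h1.div_const a).sub_const (1 / a ^ 2)).mul (h1.const_mul a).cexp).congr_deriv ?_
    field_simp
    ring
  have hlim : Tendsto (fun x : ℝ => ((x : ℂ) / a - 1 / a ^ 2) * Complex.exp (a * x))
      atTop (𝓝 0) := by
    have h0 := tendsto_rpow_mul_exp_neg_mul_atTop_nhds_zero 0 (-a.re) (by linarith)
    have h1 := tendsto_rpow_mul_exp_neg_mul_atTop_nhds_zero 1 (-a.re) (by linarith)
    have e0 : Tendsto (fun x : ℝ => Complex.exp (a * x)) atTop (𝓝 0) := by
      rw [tendsto_zero_iff_norm_tendsto_zero]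
      simpa [Complex.norm_exp] using h0
    have e1 : Tendsto (fun x : ℝ => (x : ℂ) * Complex.exp (a * x)) atTop (𝓝 0) := by
      rw [tendsto_zero_iff_norm_tendsto_zero]
      refine h1.congr' ?_
      filter_upwards [eventually_gt_atTop 0] with x hx
      simp [Complex.norm_exp, abs_of_pos hx]
    have := (e1.const_mul a⁻¹).sub (e0.const_mul (1 / a ^ 2))
    simp only [mul_zero, sub_zero] at this
    refine this.congr fun x => ?_
    field_simp
  rw [integral_Ioi_of_hasDerivAt_of_tendsto' hderiv
    (integrableOn_mul_exp_mul_complex_Ioi ha) hlim]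
  simp

lemma integrable_and_integral_exp_neg_mul_abs {b : ℝ} (hb : 0 < b) (x : ℝ) :
    Integrable (fun t : ℝ => Complex.exp (-(b * |t| : ℝ)) * Complex.exp (Complex.I * x * t)) ∧
    ∫ t : ℝ, Complex.exp (-(b * |t| : ℝ)) * Complex.exp (Complex.I * x * t) =
      ((2 * b / (b ^ 2 + x ^ 2) : ℝ) : ℂ) := by
  have hp : (-b + Complex.I * x : ℂ).re < 0 := by simpa
  have hm : (-b - Complex.I * x : ℂ).re < 0 := by simpa
  have ep : EqOn (fun t : ℝ => Complex.exp ((-b + Complex.I * x) * t))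
      (fun t : ℝ => Complex.exp (-(b * |t| : ℝ)) * Complex.exp (Complex.I * x * t)) (Ioi 0) := by
    intro t ht
    simp only [abs_of_pos (mem_Ioi.mp ht), ← Complex.exp_add]
    push_cast; ring_nf
  have em : EqOn (fun t : ℝ => Complex.exp ((-b - Complex.I * x) * t))
      (fun t : ℝ => Complex.exp (-(b * |(-t)| : ℝ)) * Complex.exp (Complex.I * x * (-t : ℝ)))
      (Ioi 0) := by
    intro t ht
    simp only [abs_neg, abs_of_pos (mem_Ioi.mp ht), ← Complex.exp_add]
    push_cast; ring_nf
  obtain ⟨h1, h2⟩ := integrable_and_integral_eq_Ioi_add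
    ((integrableOn_exp_mul_complex_Ioi hp 0).congr_fun ep measurableSet_Ioi)
    ((integrableOn_exp_mul_complex_Ioi hm 0).congr_fun em measurableSet_Ioi)
  refine ⟨h1, ?_⟩
  rw [h2, ← setIntegral_congr_fun measurableSet_Ioi ep, ← setIntegral_congr_fun measurableSet_Ioi em,
    integral_exp_mul_complex_Ioi hp, integral_exp_mul_complex_Ioi hm]
  have hp0 : (-b + Complex.I * x : ℂ) ≠ 0 := fun h => by simp [h] at hp
  have hm0 : (-b - Complex.I * x : ℂ) ≠ 0 := fun h => by simp [h] at hm
  have hq : (b ^ 2 + x ^ 2 : ℂ) = (-b + Complex.I * x) * (-b - Complex.I * x) := by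
    ring_nf; simp
  push_cast
  rw [hq]
  field_simp
  simp
  ring

lemma integral_abs_mul_exp_neg_mul_abs {b : ℝ} (hb : 0 < b) (x : ℝ) :
    ∫ t : ℝ, ((|t| : ℝ) : ℂ) * (Complex.exp (-(b * |t| : ℝ)) * Complex.exp (Complex.I * x * t)) =
      ((2 * (b ^ 2 - x ^ 2) / (b ^ 2 + x ^ 2) ^ 2 : ℝ) : ℂ) := by
  have hp : (-b + Complex.I * x : ℂ).re < 0 := by simpa
  have hm : (-b - Complex.I * x : ℂ).re < 0 := by simpa
  have ep : EqOn (fun t : ℝ => (t : ℂ) * Complex.exp ((-b + Complex.I * x) * t))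
      (fun t : ℝ => ((|t| : ℝ) : ℂ) * (Complex.exp (-(b * |t| : ℝ)) *
        Complex.exp (Complex.I * x * t))) (Ioi 0) := by
    intro t ht
    simp only [abs_of_pos (mem_Ioi.mp ht), ← Complex.exp_add]
    push_cast; ring_nf
  have em : EqOn (fun t : ℝ => (t : ℂ) * Complex.exp ((-b - Complex.I * x) * t))
      (fun t : ℝ => ((|(-t)| : ℝ) : ℂ) * (Complex.exp (-(b * |(-t)| : ℝ)) *
        Complex.exp (Complex.I * x * (-t : ℝ)))) (Ioi 0) := by
    intro t ht
    simp only [abs_neg, abs_of_pos (mem_Ioi.mp ht), ← Complex.exp_add]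
    push_cast; ring_nf
  rw [(integrable_and_integral_eq_Ioi_add
    ((integrableOn_mul_exp_mul_complex_Ioi hp).congr_fun ep measurableSet_Ioi)
    ((integrableOn_mul_exp_mul_complex_Ioi hm).congr_fun em measurableSet_Ioi)).2,
    ← setIntegral_congr_fun measurableSet_Ioi ep, ← setIntegral_congr_fun measurableSet_Ioi em,
    integral_mul_exp_mul_complex_Ioi hp, integral_mul_exp_mul_complex_Ioi hm]
  have hp0 : (-b + Complex.I * x : ℂ) ≠ 0 := fun h => by simp [h] at hp
  have hm0 : (-b - Complex.I * x : ℂ) ≠ 0 := fun h => by simp [h] at hm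
  have hq : (b ^ 2 + x ^ 2 : ℂ) = (-b + Complex.I * x) * (-b - Complex.I * x) := by
    ring_nf; simp
  push_cast
  rw [hq]
  field_simp
  ring_nf
  simp
  ring

lemma fourierInv_exp_neg_mul_abs {lam : ℝ} (hlam : 0 < lam) (y : ℝ) :
    𝓕⁻ (fun t : ℝ => Complex.exp (-(2 * Real.pi / lam * |t| : ℝ))) y =
      ((lam / (Real.pi * (1 + lam ^ 2 * y ^ 2)) : ℝ) : ℂ) := by
  have hpi := Real.pi_pos
  have h := (integrable_and_integral_exp_neg_mul_abs (b := 2 * Real.pi / lam) (by positivity)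
    (2 * Real.pi * y)).2
  have hr : 2 * (2 * Real.pi / lam) / ((2 * Real.pi / lam) ^ 2 + (2 * Real.pi * y) ^ 2) =
      lam / (Real.pi * (1 + lam ^ 2 * y ^ 2)) := by
    field_simp
  rw [hr] at h
  rw [Real.fourierInv_eq', ← h]
  refine integral_congr_ae (Eventually.of_forall fun t => ?_)
  simp only [smul_eq_mul, Real.inner_apply]
  rw [mul_comm]
  congr 2
  push_cast
  ring

lemma integrable_inv_one_add_mul_sq {lam : ℝ} (hlam : 0 < lam) :
    Integrable fun y : ℝ => (1 + lam ^ 2 * y ^ 2)⁻¹ := by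
  simpa [mul_pow] using integrable_inv_one_add_sq.comp_mul_left' hlam.ne'

lemma ft_soliton {lam : ℝ} (hlam : 0 < lam) (ξ : ℝ) :
    ft (fun y => ((4 * lam / (1 + lam ^ 2 * y ^ 2) : ℝ) : ℂ)) ξ =
      (Real.sqrt (2 * Real.pi) : ℂ)⁻¹ * (4 * Real.pi * Complex.exp (-(1 / lam * |ξ| : ℝ))) := by
  have hpi := Real.pi_pos
  set f : ℝ → ℂ := fun t : ℝ => Complex.exp (-(2 * Real.pi / lam * |t| : ℝ)) with hf
  have hcont : Continuous f := by fun_prop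
  have hint : Integrable f := by
    simpa [hf] using (integrable_and_integral_exp_neg_mul_abs (b := 2 * Real.pi / lam)
      (by positivity) 0).1
  have hinv : 𝓕⁻ f = fun y : ℝ => ((lam / (Real.pi * (1 + lam ^ 2 * y ^ 2)) : ℝ) : ℂ) :=
    funext fun y => fourierInv_exp_neg_mul_abs hlam y
  have hinvint : Integrable (𝓕⁻ f) := by
    rw [hinv]
    have h : Integrable fun y : ℝ => lam / (Real.pi * (1 + lam ^ 2 * y ^ 2)) := by
      refine ((integrable_inv_one_add_mul_sq hlam).const_mul (lam / Real.pi)).congr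
        (Eventually.of_forall fun y => ?_)
      simp only
      field_simp
    exact h.ofReal
  have hfint : Integrable (𝓕 f) := by
    have h : (fun y => 𝓕⁻ f (-y)) = 𝓕 f := by
      ext y; rw [Real.fourierInv_eq_fourier_neg, neg_neg]
    rw [← h]
    exact hinvint.comp_neg
  have key := congrFun (hcont.fourier_fourierInv_eq hint hfint) (ξ / (2 * Real.pi))
  rw [hinv, Real.fourier_real_eq_integral_exp_smul] at key
  have hval : f (ξ / (2 * Real.pi)) = Complex.exp (-(1 / lam * |ξ| : ℝ)) := by
    simp only [hf, abs_div, abs_of_pos (by positivity : 0 < 2 * Real.pi)]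
    congr 3
    field_simp
  rw [ft, ← hval, ← key]
  congr 1
  rw [← integral_const_mul]
  refine integral_congr_ae (Eventually.of_forall fun y => ?_)
  have hy : (1 + lam ^ 2 * y ^ 2 : ℂ) ≠ 0 := by
    exact_mod_cast (by positivity : (1 + lam ^ 2 * y ^ 2 : ℝ) ≠ 0)
  have hpi' : (Real.pi : ℂ) ≠ 0 := by exact_mod_cast hpi.ne'
  have he : ((-2 * Real.pi * y * (ξ / (2 * Real.pi)) : ℝ) : ℂ) * Complex.I =
      -(Complex.I * y * ξ) := by
    push_cast
    field_simp
  simp only [smul_eq_mul, he]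
  push_cast
  field_simp

lemma Dop_one_soliton {lam : ℝ} (hlam : 0 < lam) (x : ℝ) :
    Dop 1 (fun y => ((4 * lam / (1 + lam ^ 2 * y ^ 2) : ℝ) : ℂ)) x =
      ((4 * lam ^ 2 * (1 - lam ^ 2 * x ^ 2) / (1 + lam ^ 2 * x ^ 2) ^ 2 : ℝ) : ℂ) := by
  have hpi' : (Real.pi : ℂ) ≠ 0 := by exact_mod_cast Real.pi_ne_zero
  have hs : (Real.sqrt (2 * Real.pi) : ℂ)⁻¹ * (Real.sqrt (2 * Real.pi) : ℂ)⁻¹ =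
      (2 * Real.pi : ℂ)⁻¹ := by
    rw [← mul_inv]
    norm_cast
    rw [Real.mul_self_sqrt (by positivity)]
  have hint : ∀ ξ : ℝ, ((|ξ| ^ (1 : ℝ) : ℝ) : ℂ) *
      ft (fun y => ((4 * lam / (1 + lam ^ 2 * y ^ 2) : ℝ) : ℂ)) ξ *
        Complex.exp (Complex.I * x * ξ) =
      (Real.sqrt (2 * Real.pi) : ℂ)⁻¹ * (4 * Real.pi) *
        (((|ξ| : ℝ) : ℂ) * (Complex.exp (-(1 / lam * |ξ| : ℝ)) * Complex.exp (Complex.I * x * ξ))) := by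
    intro ξ
    rw [ft_soliton hlam, Real.rpow_one]
    ring
  have hr : 4 * lam ^ 2 * (1 - lam ^ 2 * x ^ 2) / (1 + lam ^ 2 * x ^ 2) ^ 2 =
      2 * (2 * ((1 / lam) ^ 2 - x ^ 2) / ((1 / lam) ^ 2 + x ^ 2) ^ 2) := by
    field_simp
    ring
  simp only [Dop, hint]
  rw [integral_const_mul, integral_abs_mul_exp_neg_mul_abs (by positivity), hr, ← mul_assoc,
    ← mul_assoc, hs, Complex.ofReal_mul]
  congr 1
  push_cast
  field_simp
  norm_num

/-- Benjamin–Ono soliton profile identity. -/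
theorem stmt18 (lam : ℝ) (hlam : 0 < lam) :
    ∀ x : ℝ,
      Dop 1 (fun y => ((4 * lam / (1 + lam ^ 2 * y ^ 2) : ℝ) : ℂ)) x =
          ((4 * lam ^ 2 * (1 - lam ^ 2 * x ^ 2) / (1 + lam ^ 2 * x ^ 2) ^ 2 : ℝ) : ℂ) ∧
      Dop 1 (fun y => ((4 * lam / (1 + lam ^ 2 * y ^ 2) : ℝ) : ℂ)) x +
          (lam : ℂ) * ((4 * lam / (1 + lam ^ 2 * x ^ 2) : ℝ) : ℂ) =
        ((4 * lam / (1 + lam ^ 2 * x ^ 2) : ℝ) : ℂ) ^ 2 / 2 := by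
  intro x
  rw [Dop_one_soliton hlam]
  refine ⟨rfl, ?_⟩
  norm_cast
  field_simp
  ring

end
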